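/- Let T be a densely defined closed right linear operator in a separable quaternionic Hilbert space with bounded transform Z_T. Then |Z_T| = |T|(I + T*T)^{-1/2}, and if U is a partial isometry with T = U|T| then Z_T = U|Z_T|. -/

import Mathlib

noncomputable section

open MulOpposite

local notation "ℍ" => Quaternion ℝ

variable {H : Type*} [NormedAddCommGroup H] [Module ℍᵐᵒᵖ H]

/-- The axioms of a quaternion-valued inner product compatible with the norm on a
right quaternionic module `H` (scalars act on the right via `ℍᵐᵒᵖ`). -/
structure QInner (inn : H → H → ℍ) : Prop where
  add_right : ∀ u v w : H, inn u (v + w) = inn u v + inn u w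
  smul_right : ∀ (u v : H) (q : ℍ), inn u (op q • v) = inn u v * q
  conj_symm : ∀ u v : H, inn u v = star (inn v u)
  norm_sq : ∀ u : H, inn u u = ((‖u‖ ^ 2 : ℝ) : ℍ)

/-- `B` is the adjoint of the bounded right linear operator `A`. -/
def IsAdjB (inn : H → H → ℍ) (A B : H →L[ℍᵐᵒᵖ] H) : Prop :=
  ∀ x y : H, inn (B x) y = inn x (A y)

/-- `A` is a positive bounded operator. -/
def IsPosB (inn : H → H → ℍ) (A : H →L[ℍᵐᵒᵖ] H) : Prop :=
  IsAdjB inn A A ∧ ∀ x : H, ∃ r : ℝ, 0 ≤ r ∧ inn x (A x) = (r : ℍ)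

/-- Orthogonal complement of a set. -/
def qOrth (inn : H → H → ℍ) (S : Set H) : Set H := {x | ∀ y ∈ S, inn y x = 0}

/-- Null space of a bounded operator. -/
def kerB (A : H →L[ℍᵐᵒᵖ] H) : Set H := {x | A x = 0}

/-- `U` is a partial isometry: it is isometric on `N(U)^⊥`. -/
def IsPartialIsomB (inn : H → H → ℍ) (U : H →L[ℍᵐᵒᵖ] H) : Prop :=
  ∀ x ∈ qOrth inn (kerB U), ‖U x‖ = ‖x‖

/-- Null space of an unbounded operator. -/
def pKer (T : H →ₗ.[ℍᵐᵒᵖ] H) : Set H := {x | ∃ hx : x ∈ T.domain, T ⟨x, hx⟩ = 0}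

/-- Range of an unbounded operator. -/
def pRan (T : H →ₗ.[ℍᵐᵒᵖ] H) : Set H := Set.range fun x : T.domain => T x

/-- `S` is the adjoint of the densely defined operator `T` : the formal adjoint
identity holds and the domain of `S` is maximal. -/
def IsAdjP (inn : H → H → ℍ) (T S : H →ₗ.[ℍᵐᵒᵖ] H) : Prop :=
  (∀ (x : S.domain) (y : T.domain), inn (x : H) (T y) = inn (S x) (y : H)) ∧
  ∀ x z : H, (∀ y : T.domain, inn x (T y) = inn z (y : H)) → x ∈ S.domain

/-- `T` is a positive (self-adjoint) unbounded operator. -/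
def IsPosP (inn : H → H → ℍ) (T : H →ₗ.[ℍᵐᵒᵖ] H) : Prop :=
  IsAdjP inn T T ∧ ∀ x : T.domain, ∃ r : ℝ, 0 ≤ r ∧ inn (x : H) (T x) = (r : ℍ)

/-- `C = S ∘ T` as unbounded operators, with the usual maximal domain. -/
def IsCompP (S T C : H →ₗ.[ℍᵐᵒᵖ] H) : Prop :=
  (∀ x : H, x ∈ C.domain ↔ ∃ hx : x ∈ T.domain, T ⟨x, hx⟩ ∈ S.domain) ∧
  ∀ (x : C.domain) (hx : (x : H) ∈ T.domain) (h2 : T ⟨x, hx⟩ ∈ S.domain),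
    C x = S ⟨T ⟨x, hx⟩, h2⟩

/-- `T = U ∘ P` where `U` is bounded and `T`, `P` are unbounded. -/
def EqCompB (T : H →ₗ.[ℍᵐᵒᵖ] H) (U : H →L[ℍᵐᵒᵖ] H) (P : H →ₗ.[ℍᵐᵒᵖ] H) : Prop :=
  T.domain = P.domain ∧
  ∀ (x : H) (hx : x ∈ T.domain) (hx' : x ∈ P.domain), T ⟨x, hx⟩ = U (P ⟨x, hx'⟩)

/-- The bounded operator `B` commutes with the unbounded operator `T`, i.e. `TB ⊆ BT`. -/
def CommP (B : H →L[ℍᵐᵒᵖ] H) (T : H →ₗ.[ℍᵐᵒᵖ] H) : Prop :=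
  ∀ x : T.domain, ∃ h : B (x : H) ∈ T.domain, T ⟨B (x : H), h⟩ = B (T x)


section Helpers

open scoped ComplexOrder InnerProductSpace

lemma core_complex {E : Type*} [NormedAddCommGroup E] [InnerProductSpace ℂ E] [CompleteSpace E]
    (C V : E →L[ℂ] E) (B : E →ₗ[ℂ] E)
    (hC : (C : E →ₗ[ℂ] E).IsPositive) (hV : (V : E →ₗ[ℂ] E).IsPositive) (hB : B.IsPositive)
    (hVV : ∀ x, V (V x) = x - C (C x))
    (hBB : ∀ x, B (B x) = C (C x) - C (C (C (C x)))) (x : E) : B x = V (C x) := by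
  have hBc : Continuous B := hB.isSymmetric.continuous
  let B' : E →L[ℂ] E := ⟨B, hBc⟩
  have hC0 : 0 ≤ C := (ContinuousLinearMap.nonneg_iff_isPositive C).2
    ((ContinuousLinearMap.isPositive_toLinearMap_iff C).1 hC)
  have hV0 : 0 ≤ V := (ContinuousLinearMap.nonneg_iff_isPositive V).2
    ((ContinuousLinearMap.isPositive_toLinearMap_iff V).1 hV)
  have hB0 : 0 ≤ B' := (ContinuousLinearMap.nonneg_iff_isPositive B').2
    ((ContinuousLinearMap.isPositive_toLinearMap_iff B').1 hB)
  have hVV' : V * V = 1 - C * C := by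
    ext x; simpa using hVV x
  have hBB' : B' * B' = C * C - C * C * (C * C) := by
    ext x; exact hBB x
  have hcomm : Commute V C := by
    have h1 : CFC.sqrt (1 - C * C) = V := CFC.sqrt_unique hVV' hV0
    have h2 : Commute (1 - C * C) C :=
      (Commute.one_left C).sub_left ((Commute.refl C).mul_left (Commute.refl C))
    rw [← h1]
    exact h2.cfcₙ_nnreal _
  have hVC0 : 0 ≤ V * C := Commute.mul_nonneg hV0 hC0 hcomm
  have hsq : (V * C) * (V * C) = B' * B' := by
    have : (V * C) * (V * C) = (V * V) * (C * C) := by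
      rw [mul_assoc, ← mul_assoc C V C, ← hcomm.eq]; simp only [mul_assoc]
    rw [this, hVV', hBB']; noncomm_ring
  have h1 := CFC.sqrt_unique hsq hVC0
  have h2 := CFC.sqrt_unique (rfl : B' * B' = _) hB0
  have h3 : B' = V * C := h2.symm.trans h1
  exact congrArg (fun A : E →L[ℂ] E => A x) h3

lemma dense_complex {E : Type*} [NormedAddCommGroup E] [InnerProductSpace ℂ E] [CompleteSpace E]
    (C : E →L[ℂ] E) (hC : (C : E →ₗ[ℂ] E).IsPositive) (hinj : ∀ x, C x = 0 → x = 0) :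
    DenseRange C := by
  have h : (LinearMap.range (C : E →ₗ[ℂ] E)).topologicalClosure = ⊤ := by
    rw [Submodule.topologicalClosure_eq_top_iff, Submodule.eq_bot_iff]
    intro x hx
    apply hinj
    rw [Submodule.mem_orthogonal] at hx
    have h1 := hx (C (C x)) ⟨C x, rfl⟩
    have h2 := hC.isSymmetric (C x) x
    simp only [ContinuousLinearMap.coe_coe] at h2
    rw [h2] at h1
    exact inner_self_eq_zero.1 h1
  have h2 := (Submodule.dense_iff_topologicalClosure_eq_top).2 h
  exact h2

variable {inn : H → H → ℍ}

lemma QInner.add_left (h : QInner inn) (u v w : H) : inn (u + v) w = inn u w + inn v w := by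
  rw [h.conj_symm, h.add_right, star_add, ← h.conj_symm, ← h.conj_symm]

lemma QInner.smul_left (h : QInner inn) (u v : H) (q : ℍ) :
    inn (op q • u) v = star q * inn u v := by
  rw [h.conj_symm, h.smul_right, star_mul, ← h.conj_symm]

lemma QInner.zero_right (h : QInner inn) (u : H) : inn u 0 = 0 := by
  simpa using h.add_right u 0 0

lemma QInner.neg_right (h : QInner inn) (u v : H) : inn u (-v) = - inn u v := by
  have := h.add_right u v (-v)
  rw [add_neg_cancel, h.zero_right] at this
  exact (neg_eq_of_add_eq_zero_right this.symm).symm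

lemma QInner.sub_right (h : QInner inn) (u v w : H) : inn u (v - w) = inn u v - inn u w := by
  rw [sub_eq_add_neg, h.add_right, h.neg_right, sub_eq_add_neg]

lemma QInner.eq_of_forall (h : QInner inn) (u v : H) (huv : ∀ z, inn z u = inn z v) : u = v := by
  have h1 : inn (u - v) (u - v) = 0 := by rw [h.sub_right, huv, sub_self]
  rw [h.norm_sq] at h1
  have h2 : ‖u - v‖ ^ 2 = 0 := by
    exact congrArg QuaternionAlgebra.re h1
  have h3 : ‖u - v‖ = 0 := by simpa using h2
  exact sub_eq_zero.1 (norm_eq_zero.1 h3)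

lemma QInner.ext_re (h : QInner inn) (a b a' b' : H)
    (hh : ∀ q : ℍ, (inn a (op q • b)).re = (inn a' (op q • b')).re) : inn a b = inn a' b' := by
  have hh : ∀ q : ℍ, (inn a b * q).re = (inn a' b' * q).re := fun q => by
    rw [← h.smul_right, ← h.smul_right]; exact hh q
  simp only [Quaternion.re_mul] at hh
  have h1 := hh ⟨1, 0, 0, 0⟩
  have h2 := hh ⟨0, 1, 0, 0⟩
  have h3 := hh ⟨0, 0, 1, 0⟩
  have h4 := hh ⟨0, 0, 0, 1⟩
  simp at h1 h2 h3 h4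
  ext <;> assumption

lemma QInner.norm_smul (h : QInner inn) (q : ℍ) (u : H) : ‖op q • u‖ = ‖q‖ * ‖u‖ := by
  have h1 := h.norm_sq (op q • u)
  rw [h.smul_left, h.smul_right, h.norm_sq] at h1
  have h2 : star q * (((‖u‖ ^ 2 : ℝ) : ℍ) * q) = (((‖q‖ * ‖u‖) ^ 2 : ℝ) : ℍ) := by
    rw [(Quaternion.coe_commutes _ q), ← mul_assoc, Quaternion.star_mul_self,
      Quaternion.normSq_eq_norm_mul_self]
    rw [← Quaternion.coe_mul]
    congr 1; ring
  rw [h2] at h1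
  have h3 := Quaternion.coe_injective h1
  exact ((pow_left_inj₀ (by positivity) (by positivity) two_ne_zero).1 h3).symm

/-- The complex structure on `H` induced by right multiplication by complex numbers. -/
@[reducible] def cModule (H : Type*) [NormedAddCommGroup H] [Module ℍᵐᵒᵖ H] : Module ℂ H :=
  Module.compHom H ((Quaternion.ofComplex : ℂ →ₐ[ℝ] ℍ).toRingHom.toOpposite
    (fun x y => by
      change Quaternion.ofComplex x * Quaternion.ofComplex y
        = Quaternion.ofComplex y * Quaternion.ofComplex x
      rw [← map_mul, mul_comm, map_mul]))

/-- The complex inner product space structure on `H`. -/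
@[reducible] def cInner (h : QInner inn) : InnerProductSpace ℂ H :=
  { cModule H with
    norm_smul_le := fun c x => by
      change ‖op (Quaternion.coeComplex c) • x‖ ≤ _
      rw [h.norm_smul]
      refine le_of_eq (congrArg (· * ‖x‖) ?_)
      have := Quaternion.normSq_eq_norm_mul_self (Quaternion.coeComplex c)
      rw [Quaternion.normSq_def'] at this
      have h2 := Complex.normSq_eq_norm_sq c
      rw [Complex.normSq_apply] at h2
      simp at this
      refine (pow_left_inj₀ (norm_nonneg _) (norm_nonneg _) two_ne_zero).1 ?_
      nlinarith
    inner := fun x y => ⟨(inn x y).re, (inn x y).imI⟩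
    norm_sq_eq_re_inner := fun x => by
      rw [h.norm_sq]; rfl
    conj_inner_symm := fun x y => by
      rw [h.conj_symm x y]
      apply Complex.ext <;> simp
    add_left := fun x y z => by
      rw [h.add_left]
      apply Complex.ext <;> simp
    smul_left := fun x y c => by
      change (⟨(inn (op (Quaternion.coeComplex c) • x) y).re,
        (inn (op (Quaternion.coeComplex c) • x) y).imI⟩ : ℂ) = _
      rw [h.smul_left]
      apply Complex.ext <;> simp [Quaternion.re_mul, Quaternion.imI_mul] }

/-- Key bounded-operator fact, stated without the complex structure. -/
lemma core_quat [CompleteSpace H] (h : QInner inn) (C V : H →L[ℍᵐᵒᵖ] H) (B : H →ₗ[ℍᵐᵒᵖ] H)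
    (hC : IsPosB inn C) (hV : IsPosB inn V)
    (hBs : ∀ x y, inn (B x) y = inn x (B y))
    (hBp : ∀ x, 0 ≤ (inn x (B x)).re)
    (hinj : ∀ x, C x = 0 → x = 0)
    (hVV : ∀ x, V (V (C x)) = C x - C (C (C x)))
    (hBB : ∀ x, B (B x) = C (C x) - C (C (C (C x)))) :
    (∀ x, B x = V (C x)) ∧ DenseRange C ∧
      ∀ a b : H, (Continuous fun x : H => (inn (C x) a).re) ∧
        (Continuous fun x : H => (inn (V x) b).re) ∧ Continuous fun x : H => (inn b x).re := by
  let _ := cInner h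
  let C' : H →L[ℂ] H :=
    ⟨⟨⟨C, fun x y => map_add C x y⟩, fun c x => map_smul C (op (Quaternion.coeComplex c)) x⟩,
      C.continuous⟩
  let V' : H →L[ℂ] H :=
    ⟨⟨⟨V, fun x y => map_add V x y⟩, fun c x => map_smul V (op (Quaternion.coeComplex c)) x⟩,
      V.continuous⟩
  let B' : H →ₗ[ℂ] H :=
    ⟨⟨B, fun x y => map_add B x y⟩, fun c x => map_smul B (op (Quaternion.coeComplex c)) x⟩
  have hin : ∀ x y : H, ⟪x, y⟫_ℂ = ⟨(inn x y).re, (inn x y).imI⟩ := fun _ _ => rfl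
  have hC' : (C' : H →ₗ[ℂ] H).IsPositive := by
    refine ⟨fun x y => ?_, fun x => ?_⟩
    · rw [hin, hin]
      change (⟨(inn (C x) y).re, (inn (C x) y).imI⟩ : ℂ) = ⟨(inn x (C y)).re, (inn x (C y)).imI⟩
      rw [hC.1 x y]
    · rw [hin]
      change 0 ≤ (inn (C x) x).re
      obtain ⟨r, hr, e⟩ := hC.2 x
      rw [hC.1 x x, e]; simpa using hr
  have hV' : (V' : H →ₗ[ℂ] H).IsPositive := by
    refine ⟨fun x y => ?_, fun x => ?_⟩
    · rw [hin, hin]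
      change (⟨(inn (V x) y).re, (inn (V x) y).imI⟩ : ℂ) = ⟨(inn x (V y)).re, (inn x (V y)).imI⟩
      rw [hV.1 x y]
    · rw [hin]
      change 0 ≤ (inn (V x) x).re
      obtain ⟨r, hr, e⟩ := hV.2 x
      rw [hV.1 x x, e]; simpa using hr
  have hB' : B'.IsPositive := by
    refine ⟨fun x y => ?_, fun x => ?_⟩
    · rw [hin, hin]
      change (⟨(inn (B x) y).re, (inn (B x) y).imI⟩ : ℂ) = ⟨(inn x (B y)).re, (inn x (B y)).imI⟩
      rw [hBs x y]
    · rw [hin]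
      change 0 ≤ (inn (B x) x).re
      rw [hBs x x]; exact hBp x
  have hd : DenseRange C := dense_complex C' hC' hinj
  have hVV' : ∀ x, V (V x) = x - C (C x) := by
    have : (fun x => V (V x)) = fun x => x - C (C x) :=
      hd.equalizer (V.continuous.comp V.continuous)
        (continuous_id.sub (C.continuous.comp C.continuous)) (funext hVV)
    exact fun x => congrFun this x
  refine ⟨core_complex C' V' B' hC' hV' hB' hVV' hBB, hd, fun a b => ⟨?_, ?_, ?_⟩⟩
  · have : Continuous fun x : H => (⟪C x, a⟫_ℂ).re :=
      Complex.continuous_re.comp (C.continuous.inner continuous_const)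
    exact this
  · have : Continuous fun x : H => (⟪V x, b⟫_ℂ).re :=
      Complex.continuous_re.comp (V.continuous.inner continuous_const)
    exact this
  · have : Continuous fun x : H => (⟪b, x⟫_ℂ).re :=
      Complex.continuous_re.comp (continuous_const.inner continuous_id)
    exact this

end Helpers

/-- for a densely defined closed operator `T` in a separable quaternionic
Hilbert space with bounded transform `Z = T C`, where `C = (I + T*T)^{-1/2}`:
`|Z| = |T| (I + T*T)^{-1/2}`, and if `U` is a partial isometry with `T = U |T|` then
`Z = U |Z|`. Here `Ts = T*`, `TsT = T*T`, `modT = |T|`, `Zs = Z*`, `modZ = |Z|`. -/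
theorem boundedTransform_modulus_and_factorization
    [CompleteSpace H] [TopologicalSpace.SeparableSpace H]
    (inn : H → H → ℍ) (hinn : QInner inn)
    (T Ts TsT modT : H →ₗ.[ℍᵐᵒᵖ] H) (C Z Zs modZ U : H →L[ℍᵐᵒᵖ] H)
    (hdense : Dense (T.domain : Set H))
    (hclosed : IsClosed (T.graph : Set (H × H)))
    (hadj : IsAdjP inn T Ts) (hcomp : IsCompP Ts T TsT)
    (hmodTpos : IsPosP inn modT) (hmodTsq : IsCompP modT modT TsT)
    (hCpos : IsPosB inn C)
    (hCdom : ∀ x : H, C (C x) ∈ TsT.domain)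
    (hCinv : ∀ x : H, C (C x) + TsT ⟨C (C x), hCdom x⟩ = x)
    (hCinv' : ∀ x : TsT.domain, C (C ((x : H) + TsT x)) = (x : H))
    (hZ : ∀ x : H, ∃ h : C x ∈ T.domain, Z x = T ⟨C x, h⟩)
    (hZadj : IsAdjB inn Z Zs)
    (hmodZpos : IsPosB inn modZ) (hmodZsq : modZ.comp modZ = Zs.comp Z)
    (hU : IsPartialIsomB inn U) (hUfact : EqCompB T U modT) :
    (∀ x : H, ∃ h : C x ∈ modT.domain, modZ x = modT ⟨C x, h⟩) ∧
    (∀ x : H, Z x = U (modZ x)) := by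
  have hinj : ∀ x, C x = 0 → x = 0 := by
    intro x hx
    have h1 : C (C x) = 0 := by rw [hx, map_zero]
    have h2 := hCinv x
    have h3 : (⟨C (C x), hCdom x⟩ : TsT.domain) = 0 := Subtype.ext h1
    rw [h3, LinearPMap.map_zero, h1, add_zero] at h2
    exact h2.symm
  have hTsT : ∀ x, TsT ⟨C (C x), hCdom x⟩ = x - C (C x) :=
    fun x => eq_sub_of_add_eq' (hCinv x)
  -- the square of `modZ`
  have hVV : ∀ x, modZ (modZ (C x)) = C x - C (C (C x)) := by
    intro y
    have e : modZ (modZ (C y)) = Zs (Z (C y)) :=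
      congrArg (fun A : H →L[ℍᵐᵒᵖ] H => A (C y)) hmodZsq
    rw [e]
    apply hinn.eq_of_forall
    intro z
    obtain ⟨h1, e1⟩ := hZ z
    obtain ⟨h2, e2⟩ := hZ (C y)
    obtain ⟨h3, h4⟩ := (hcomp.1 _).1 (hCdom y)
    have e3 := hcomp.2 ⟨C (C y), hCdom y⟩ h3 h4
    rw [hTsT] at e3
    have e4 := hadj.1 ⟨T ⟨C (C y), h3⟩, h4⟩ ⟨C z, h1⟩
    rw [← e3] at e4
    have e5 : inn (Zs (Z (C y))) z = inn (C y - C (C (C y))) z := by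
      rw [hZadj, e1, e2, e4, ← hCpos.1, map_sub]
    rw [hinn.conj_symm, e5, ← hinn.conj_symm]
  -- `B = modT C²`
  have hM : ∀ x, ∃ h1 : C (C x) ∈ modT.domain, ∃ h2 : modT ⟨C (C x), h1⟩ ∈ modT.domain,
      modT ⟨modT ⟨C (C x), h1⟩, h2⟩ = x - C (C x) := by
    intro x
    obtain ⟨h3, h4⟩ := (hmodTsq.1 _).1 (hCdom x)
    refine ⟨h3, h4, ?_⟩
    rw [← hTsT, hmodTsq.2 ⟨C (C x), hCdom x⟩ h3 h4]
  have hM1 : ∀ x, C (C x) ∈ modT.domain := fun x => (hM x).1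
  have hM2 : ∀ x, modT ⟨C (C x), hM1 x⟩ ∈ modT.domain := fun x => (hM x).2.1
  have hM3 : ∀ x, modT ⟨modT ⟨C (C x), hM1 x⟩, hM2 x⟩ = x - C (C x) := fun x => (hM x).2.2
  let B : H →ₗ[ℍᵐᵒᵖ] H :=
    { toFun := fun x => modT ⟨C (C x), hM1 x⟩
      map_add' := fun x y => by
        rw [← LinearPMap.map_add]
        congr 1; apply Subtype.ext; simp
      map_smul' := fun q x => by
        rw [RingHom.id_apply, ← LinearPMap.map_smul]
        congr 1; apply Subtype.ext; simp }
  have hBdef : ∀ x, B x = modT ⟨C (C x), hM1 x⟩ := fun _ => rfl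
  have hBdom : ∀ x, B x ∈ modT.domain := hM2
  have hMB : ∀ x, modT ⟨B x, hBdom x⟩ = x - C (C x) := hM3
  have hBs : ∀ x y, inn (B x) y = inn x (B y) := by
    intro x y
    have a1 : inn (B x) (C (C y)) = inn (C (C x)) (B y) :=
      (hmodTpos.1.1 ⟨C (C x), hM1 x⟩ ⟨C (C y), hM1 y⟩).symm
    have a2 := hmodTpos.1.1 ⟨B x, hBdom x⟩ ⟨B y, hBdom y⟩
    rw [hMB, hMB] at a2
    simp only at a2
    have e1 : y = C (C y) + (y - C (C y)) := by abel
    have e2 : x = C (C x) + (x - C (C x)) := by abel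
    calc inn (B x) y = inn (B x) (C (C y) + (y - C (C y))) := by rw [← e1]
      _ = inn (C (C x) + (x - C (C x))) (B y) := by
        rw [hinn.add_right, hinn.add_left, a1, a2]
      _ = inn x (B y) := by rw [← e2]
  have hBp : ∀ x, 0 ≤ (inn x (B x)).re := by
    intro x
    have e2 : x = C (C x) + (x - C (C x)) := by abel
    have e3 : inn x (B x) = inn (C (C x)) (B x) + inn (x - C (C x)) (B x) := by
      rw [← hinn.add_left, ← e2]
    obtain ⟨r, hr, er⟩ := hmodTpos.2 ⟨C (C x), hM1 x⟩
    obtain ⟨s, hs, es⟩ := hmodTpos.2 ⟨B x, hBdom x⟩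
    have a2 := hmodTpos.1.1 ⟨B x, hBdom x⟩ ⟨B x, hBdom x⟩
    rw [es, hMB] at a2
    simp only at a2
    rw [← hBdef] at er
    simp only at er
    rw [e3, er, ← a2]
    simpa using add_nonneg hr hs
  have hcommB : ∀ x (hx : x ∈ modT.domain), C (C (modT ⟨x, hx⟩)) = B x := by
    intro x hx
    have d : modT ⟨B x, hBdom x⟩ ∈ modT.domain := by
      rw [hMB]; exact modT.domain.sub_mem hx (hM1 x)
    have d2 : B x ∈ TsT.domain := (hmodTsq.1 _).2 ⟨hBdom x, d⟩
    have e := hmodTsq.2 ⟨B x, d2⟩ (hBdom x) d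
    have e2 : modT ⟨modT ⟨B x, hBdom x⟩, d⟩ = modT ⟨x, hx⟩ - B x := by
      change _ = modT ⟨x, hx⟩ - modT ⟨C (C x), hM1 x⟩
      rw [← LinearPMap.map_sub]
      congr 1; apply Subtype.ext; exact hMB x
    have e3 := hCinv' ⟨B x, d2⟩
    rw [e, e2] at e3
    simpa using e3
  have hBB : ∀ x, B (B x) = C (C x) - C (C (C (C x))) := by
    intro x
    rw [← hcommB (B x) (hBdom x), hMB, map_sub, map_sub]
  obtain ⟨hBV, hd, hcont⟩ := core_quat hinn C modZ B hCpos hmodZpos hBs hBp hinj hVV hBB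
  -- extension to all vectors by closedness of `modT`
  have hre : ∀ (y : modT.domain) (x : H), (inn (C x) (modT y)).re = (inn (modZ x) (y : H)).re := by
    intro y
    have : (fun x => (inn (C x) (modT y)).re) = fun x => (inn (modZ x) (y : H)).re := by
      refine hd.equalizer (hcont (modT y) y).1 (hcont (modT y) y).2.1 (funext fun x => ?_)
      have := hmodTpos.1.1 ⟨C (C x), hM1 x⟩ y
      rw [← hBdef, hBV] at this
      exact congrArg QuaternionAlgebra.re this
    exact fun x => congrFun this x
  have hq : ∀ (y : modT.domain) (x : H), inn (C x) (modT y) = inn (modZ x) (y : H) := by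
    intro y x
    apply hinn.ext_re
    intro q
    rw [← LinearPMap.map_smul]
    exact hre (op q • y) x
  have hdomC : ∀ x, C x ∈ modT.domain := fun x => hmodTpos.1.2 _ (modZ x) fun y => hq y x
  have hW : ∀ x, modZ x = modT ⟨C x, hdomC x⟩ := by
    intro x
    have hdM : Dense (modT.domain : Set H) := hUfact.1 ▸ hdense
    have hz : ∀ y : H, (inn (modZ x - modT ⟨C x, hdomC x⟩) y).re = 0 := by
      have : (fun y => (inn (modZ x - modT ⟨C x, hdomC x⟩) y).re) = fun _ => 0 := by
        refine Continuous.ext_on hdM (hcont 0 _).2.2 continuous_const fun y hy => ?_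
        have e1 := hq ⟨y, hy⟩ x
        have e2 := hmodTpos.1.1 ⟨C x, hdomC x⟩ ⟨y, hy⟩
        rw [e1] at e2
        simp only at e2
        have e3 : inn (modZ x - modT ⟨C x, hdomC x⟩) y = 0 := by
          rw [hinn.conj_symm, hinn.sub_right, star_sub, ← hinn.conj_symm, ← hinn.conj_symm, e2,
            sub_self]
        simp only [e3, Quaternion.re_zero]
      exact fun y => congrFun this y
    have h1 := hz (modZ x - modT ⟨C x, hdomC x⟩)
    rw [hinn.norm_sq] at h1
    simp only [Quaternion.re_coe] at h1
    exact sub_eq_zero.1 (norm_eq_zero.1 (by simpa using h1))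
  refine ⟨fun x => ⟨hdomC x, hW x⟩, fun x => ?_⟩
  obtain ⟨h, e⟩ := hZ x
  rw [e, hW x]
  exact hUfact.2 _ h (hdomC x)
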